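/- Let G = (V,E) be a finite simple graph satisfying the Laman conditions that admits a calligraphic split. Then for every generic edge-length assignment λ : E → ℝ_{>0}, the (finite) number of congruence classes of spherical realizations of G inducing λ is even. -/

import Mathlib

/-- A finite simple graph: vertices are a finite set of naturals, edges are
two-element subsets of the vertex set. -/
structure GeoGraph where
  V : Finset ℕ
  E : Finset (Finset ℕ)
  edge_sub : ∀ e ∈ E, e ⊆ V
  edge_two : ∀ e ∈ E, e.card = 2

def IsSubgraph (G' G : GeoGraph) : Prop :=
  G'.V ⊆ G.V ∧ G'.E ⊆ G.E

/-- The Laman conditions: `|E| = 2|V| - 3` and every subgraph with at least two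
vertices satisfies `|E'| ≤ 2|V'| - 3`. -/
def Laman (G : GeoGraph) : Prop :=
  2 ≤ G.V.card ∧ G.E.card = 2 * G.V.card - 3 ∧
    ∀ G' : GeoGraph, IsSubgraph G' G → 2 ≤ G'.V.card → G'.E.card ≤ 2 * G'.V.card - 3

/-- A generic edge-length assignment: positive real edge lengths that are
algebraically independent over ℚ. -/
def Generic (G : GeoGraph) (lam : Finset ℕ → ℝ) : Prop :=
  (∀ e ∈ G.E, 0 < lam e) ∧
    AlgebraicIndependent ℚ (fun e : G.E => lam e.1)

/-- A spherical realization: every vertex goes to the complex sphere. -/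
def SphereRealization (G : GeoGraph) (ρ : ℕ → Fin 3 → ℂ) : Prop :=
  ∀ v ∈ G.V, ∑ i, ρ v i ^ 2 = 1

/-- A realization induces the edge lengths `lam`. -/
def SphereInduces (G : GeoGraph) (ρ : ℕ → Fin 3 → ℂ) (lam : Finset ℕ → ℝ) : Prop :=
  ∀ u v : ℕ, ({u, v} : Finset ℕ) ∈ G.E →
    ∑ i, (ρ u i - ρ v i) ^ 2 = (lam {u, v} : ℂ)

/-- Congruence of spherical realizations via `SO₃(ℂ)`. -/
def SphereCongruent (G : GeoGraph) (ρ ρ' : ℕ → Fin 3 → ℂ) : Prop :=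
  ∃ A : Matrix (Fin 3) (Fin 3) ℂ, A * A.transpose = 1 ∧ A.det = 1 ∧
    ∀ v ∈ G.V, ρ' v = A.mulVec (ρ v)

/-- Congruence classes of spherical realizations of `G` inducing `lam`. -/
def SphereClasses (G : GeoGraph) (lam : Finset ℕ → ℝ) : Type :=
  Quot fun ρ ρ' : {ρ : ℕ → Fin 3 → ℂ // SphereRealization G ρ ∧ SphereInduces G ρ lam} =>
    SphereCongruent G ρ.1 ρ'.1

def PlaneInduces (G : GeoGraph) (ρ : ℕ → Fin 2 → ℂ) (lam : Finset ℕ → ℝ) : Prop :=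
  ∀ u v : ℕ, ({u, v} : Finset ℕ) ∈ G.E →
    ∑ i, (ρ u i - ρ v i) ^ 2 = (lam {u, v} : ℂ)

/-- Congruence of plane realizations via `SO₂(ℂ)` and a translation. -/
def PlaneCongruent (G : GeoGraph) (ρ ρ' : ℕ → Fin 2 → ℂ) : Prop :=
  ∃ A : Matrix (Fin 2) (Fin 2) ℂ, ∃ b : Fin 2 → ℂ, A * A.transpose = 1 ∧ A.det = 1 ∧
    ∀ v ∈ G.V, ρ' v = A.mulVec (ρ v) + b

/-- Congruence classes of plane realizations of `G` inducing `lam`. -/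
def PlaneClasses (G : GeoGraph) (lam : Finset ℕ → ℝ) : Type :=
  Quot fun ρ ρ' : {ρ : ℕ → Fin 2 → ℂ // PlaneInduces G ρ lam} =>
    PlaneCongruent G ρ.1 ρ'.1

/-- A calligraph: `{0,1,2} ⊆ V`, `{1,2} ∈ E`, `|E| = 2|V| - 4`, and adding the
edge `{0,1}` or the edge `{0,2}` yields a graph satisfying the Laman conditions. -/
def Calligraph (H : GeoGraph) : Prop :=
  ({0, 1, 2} : Finset ℕ) ⊆ H.V ∧ ({1, 2} : Finset ℕ) ∈ H.E ∧
    H.E.card = 2 * H.V.card - 4 ∧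
    ((∃ H' : GeoGraph, H'.V = H.V ∧ H'.E = insert {0, 1} H.E ∧ Laman H') ∨
     (∃ H' : GeoGraph, H'.V = H.V ∧ H'.E = insert {0, 2} H.E ∧ Laman H'))

/-- A split of `G` into two subgraphs sharing exactly the vertices `0,1,2` and
the edge `{1,2}`. -/
def IsSplit (G G₁ G₂ : GeoGraph) : Prop :=
  G.V = G₁.V ∪ G₂.V ∧ G.E = G₁.E ∪ G₂.E ∧
    G₁.V ∩ G₂.V = ({0, 1, 2} : Finset ℕ) ∧
    G₁.E ∩ G₂.E = ({{1, 2}} : Finset (Finset ℕ))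

/-- A calligraphic split: a split into two calligraphs. -/
def CalligraphicSplit (G G₁ G₂ : GeoGraph) : Prop :=
  IsSplit G G₁ G₂ ∧ Calligraph G₁ ∧ Calligraph G₂

open Algebra in
theorem isAlgebraic_adjoin_range_of_ncard_le {F ι : Type*} [Field F] [CharZero F] [Finite ι]
    {μ : ι → F} (hμ : AlgebraicIndependent ℚ μ) {T : Set F} (hfin : T.Finite)
    (hT : ∀ i, IsAlgebraic (adjoin ℚ T) (μ i)) :
    Nat.card ι ≤ T.ncard ∧ (T.ncard ≤ Nat.card ι →
      ∀ x : F, IsAlgebraic (adjoin ℚ T) x → IsAlgebraic (adjoin ℚ (Set.range μ)) x) := by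
  set M := AlgebraicIndependent.matroid ℚ F with hM
  have hcl : ∀ (s : Set F) (x : F), x ∈ M.closure s ↔ IsAlgebraic (adjoin ℚ s) x := by
    intro s x
    rw [hM, AlgebraicIndependent.matroid_closure_eq]
    exact Iff.rfl
  have hind : M.Indep (Set.range μ) := AlgebraicIndependent.matroid_indep_iff.2 hμ.coe_range
  have hsub : Set.range μ ⊆ M.closure T := by
    rintro _ ⟨i, rfl⟩
    exact (hcl _ _).2 (hT i)
  have hcard : (Set.range μ).encard = Nat.card ι := by
    rw [← Set.image_univ, hμ.injective.encard_image, Set.encard_univ, ENat.card_eq_coe_natCard]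
  have hrk : M.eRk T ≤ T.ncard := by
    rw [hfin.cast_ncard_eq]
    exact M.eRk_le_encard T
  constructor
  · have h := hind.encard_le_eRk_of_subset hsub
    rw [M.eRk_closure_eq, hcard] at h
    exact_mod_cast h.trans hrk
  · intro hle x hx
    have hfinrk : M.IsRkFinite (Set.range μ) := M.isRkFinite_of_finite (Set.finite_range μ)
    have h := hfinrk.closure_eq_closure_of_subset_of_eRk_ge_eRk hsub (by
      rw [M.eRk_closure_eq, hind.eRk_eq_encard, hcard]
      exact hrk.trans (by exact_mod_cast hle))
    rw [← hcl, h, M.closure_closure, hcl]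
    exact hx

/-- The Gram determinant of the triples `a, b, u` and `a, b, v`, for unit vectors `a` and `b`,
solved for the entry `u ⬝ᵥ v`. -/
theorem gram_mul_eq_dotProduct {F : Type*} [CommRing F] {a b : Fin 3 → F} (ha : a ⬝ᵥ a = 1)
    (hb : b ⬝ᵥ b = 1) (u v : Fin 3 → F) :
    (1 - (a ⬝ᵥ b) ^ 2) * (u ⬝ᵥ v) =
      (u ⬝ᵥ a) * (v ⬝ᵥ a) + (u ⬝ᵥ b) * (v ⬝ᵥ b)
        - (a ⬝ᵥ b) * ((u ⬝ᵥ a) * (v ⬝ᵥ b) + (u ⬝ᵥ b) * (v ⬝ᵥ a))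
        + (Matrix.of ![a, b, u]).det * (Matrix.of ![a, b, v]).det := by
  have key : ((a ⬝ᵥ a) * (b ⬝ᵥ b) - (a ⬝ᵥ b) ^ 2) * (u ⬝ᵥ v) =
      (b ⬝ᵥ b) * ((u ⬝ᵥ a) * (v ⬝ᵥ a)) + (a ⬝ᵥ a) * ((u ⬝ᵥ b) * (v ⬝ᵥ b))
        - (a ⬝ᵥ b) * ((u ⬝ᵥ a) * (v ⬝ᵥ b) + (u ⬝ᵥ b) * (v ⬝ᵥ a))
        + (Matrix.of ![a, b, u]).det * (Matrix.of ![a, b, v]).det := by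
    simp only [dotProduct, Fin.sum_univ_three, Matrix.det_fin_three, Matrix.of_apply,
      Matrix.cons_val]
    ring
  simpa [ha, hb] using key

open Algebra in
theorem isAlgebraic_gram_of_frame {F : Type*} [Field F] [CharZero F] {T : Set F}
    {a b : Fin 3 → F} (ha : a ⬝ᵥ a = 1) (hb : b ⬝ᵥ b = 1) (hab : (a ⬝ᵥ b) ^ 2 ≠ 1)
    (hg : IsAlgebraic (adjoin ℚ T) (a ⬝ᵥ b)) :
    (∀ u, u ⬝ᵥ u = 1 → IsAlgebraic (adjoin ℚ T) (u ⬝ᵥ a) → IsAlgebraic (adjoin ℚ T) (u ⬝ᵥ b) →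
      IsAlgebraic (adjoin ℚ T) (Matrix.of ![a, b, u]).det) ∧
    (∀ u v, u ⬝ᵥ u = 1 → v ⬝ᵥ v = 1 →
      IsAlgebraic (adjoin ℚ T) (u ⬝ᵥ a) → IsAlgebraic (adjoin ℚ T) (u ⬝ᵥ b) →
      IsAlgebraic (adjoin ℚ T) (v ⬝ᵥ a) → IsAlgebraic (adjoin ℚ T) (v ⬝ᵥ b) →
      IsAlgebraic (adjoin ℚ T) (u ⬝ᵥ v)) := by
  have h1 : IsAlgebraic (adjoin ℚ T) (1 : F) := isAlgebraic_one
  have hdet : ∀ u, u ⬝ᵥ u = 1 → IsAlgebraic (adjoin ℚ T) (u ⬝ᵥ a) →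
      IsAlgebraic (adjoin ℚ T) (u ⬝ᵥ b) →
      IsAlgebraic (adjoin ℚ T) (Matrix.of ![a, b, u]).det := by
    intro u hu hua hub
    refine IsAlgebraic.of_pow (n := 2) (by norm_num) ?_
    have key := gram_mul_eq_dotProduct ha hb u u
    have : (Matrix.of ![a, b, u]).det ^ 2 = (1 - (a ⬝ᵥ b) ^ 2)
        - ((u ⬝ᵥ a) * (u ⬝ᵥ a) + (u ⬝ᵥ b) * (u ⬝ᵥ b)
        - (a ⬝ᵥ b) * ((u ⬝ᵥ a) * (u ⬝ᵥ b) + (u ⬝ᵥ b) * (u ⬝ᵥ a))) := by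
      rw [hu] at key
      linear_combination -key
    rw [this]
    exact (h1.sub (hg.pow 2)).sub (((hua.mul hua).add (hub.mul hub)).sub
      (hg.mul ((hua.mul hub).add (hub.mul hua))))
  refine ⟨hdet, fun u v hu hv hua hub hva hvb => ?_⟩
  have hδ : 1 - (a ⬝ᵥ b) ^ 2 ≠ 0 := sub_ne_zero.2 (Ne.symm hab)
  have : u ⬝ᵥ v = (1 - (a ⬝ᵥ b) ^ 2)⁻¹ * ((u ⬝ᵥ a) * (v ⬝ᵥ a) + (u ⬝ᵥ b) * (v ⬝ᵥ b)
        - (a ⬝ᵥ b) * ((u ⬝ᵥ a) * (v ⬝ᵥ b) + (u ⬝ᵥ b) * (v ⬝ᵥ a))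
        + (Matrix.of ![a, b, u]).det * (Matrix.of ![a, b, v]).det) := by
    rw [← gram_mul_eq_dotProduct ha hb u v, inv_mul_cancel_left₀ hδ]
  rw [this]
  exact (h1.sub (hg.pow 2)).inv.mul ((((hua.mul hva).add (hub.mul hvb)).sub
      (hg.mul ((hua.mul hvb).add (hub.mul hva)))).add ((hdet u hu hua hub).mul (hdet v hv hva hvb)))

/-- If a polynomial map takes an algebraic value at every point, over every extension field, of the
Zariski closure of a set, then it takes finitely many values on that set. -/
theorem finite_image_aeval_of_isAlgebraic {K Ω σ : Type} [Field K] [Field Ω] [Algebra K Ω]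
    [Finite σ] (S : Set (σ → Ω)) (f : MvPolynomial σ K)
    (h : ∀ (F : Type) [Field F] [Algebra K F] (y : σ → F),
      (∀ p : MvPolynomial σ K, (∀ s ∈ S, MvPolynomial.aeval s p = 0) →
        MvPolynomial.aeval y p = 0) → IsAlgebraic K (MvPolynomial.aeval y f)) :
    ((fun s : σ → Ω => MvPolynomial.aeval s f) '' S).Finite := by
  set I : Ideal (MvPolynomial σ K) :=
    ⨅ s ∈ S, RingHom.ker (MvPolynomial.aeval (R := K) s) with hI
  have hroot : ∀ P ∈ I.minimalPrimes, ∃ m : Polynomial K, m ≠ 0 ∧ Polynomial.aeval f m ∈ P := by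
    intro P hP
    have hprime : P.IsPrime := hP.1.1
    let A := MvPolynomial σ K ⧸ P
    let F := FractionRing A
    let y : σ → F := fun i => algebraMap A F (Ideal.Quotient.mk P (MvPolynomial.X i))
    have hy : ∀ p : MvPolynomial σ K,
        MvPolynomial.aeval y p = algebraMap A F (Ideal.Quotient.mk P p) := by
      intro p
      have : MvPolynomial.aeval y =
          (IsScalarTower.toAlgHom K A F).comp (Ideal.Quotient.mkₐ K P) :=
        MvPolynomial.algHom_ext fun i => by simp [y]; rfl
      rw [this]
      rfl
    have hinj : Function.Injective (algebraMap A F) := IsFractionRing.injective A F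
    obtain ⟨m, hm, hm0⟩ := h F y (fun p hp => by
      rw [hy, Ideal.Quotient.eq_zero_iff_mem.2, map_zero]
      refine hP.1.2 ?_
      simpa [hI, Submodule.mem_iInf, RingHom.mem_ker] using hp)
    refine ⟨m, hm, ?_⟩
    rw [Polynomial.aeval_algHom_apply, hy] at hm0
    exact Ideal.Quotient.eq_zero_iff_mem.1 (hinj (by rw [hm0, map_zero]))
  choose! m hm hmP using hroot
  refine Set.Finite.subset (Set.Finite.biUnion (I.finite_minimalPrimes_of_isNoetherianRing _)
    fun P _ => (m P).rootSet_finite Ω) ?_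
  rintro _ ⟨s, hs, rfl⟩
  have hker : (RingHom.ker (MvPolynomial.aeval (R := K) s)).IsPrime := RingHom.ker_isPrime _
  obtain ⟨P, hP, hle⟩ := Ideal.exists_minimalPrimes_le
    (show I ≤ RingHom.ker (MvPolynomial.aeval (R := K) s) from iInf₂_le s hs)
  refine Set.mem_biUnion hP ((Polynomial.mem_rootSet_of_ne (hm P hP)).2 ?_)
  rw [Polynomial.aeval_algHom_apply]
  exact hle (hmP P hP)

open Algebra in
/-- A generic spherical realization with `2|V| - 3` edges has all its Gram invariants algebraic over
the field of edge lengths, and no vertex is coplanar with a given edge and the origin. -/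
theorem isAlgebraic_of_induces {F : Type*} [Field F] [CharZero F] (G : GeoGraph)
    (hE : G.E.card = 2 * G.V.card - 3) {a b : ℕ} (hne : a ≠ b) (hab : {a, b} ∈ G.E)
    {y : ℕ → Fin 3 → F} (hy : ∀ v ∈ G.V, y v ⬝ᵥ y v = 1) {μ : G.E → F}
    (hμ : AlgebraicIndependent ℚ μ)
    (hμy : ∀ (u v : ℕ) (h : {u, v} ∈ G.E), (y u - y v) ⬝ᵥ (y u - y v) = μ ⟨{u, v}, h⟩) :
    (∀ u ∈ G.V, ∀ v ∈ G.V, IsAlgebraic (adjoin ℚ (Set.range μ)) (y u ⬝ᵥ y v)) ∧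
    (∀ v ∈ G.V, IsAlgebraic (adjoin ℚ (Set.range μ)) (Matrix.of ![y a, y b, y v]).det) ∧
    ∀ v ∈ G.V, v ≠ a → v ≠ b → (Matrix.of ![y a, y b, y v]).det ≠ 0 := by
  classical
  have haV : a ∈ G.V := G.edge_sub _ hab (by simp)
  have hbV : b ∈ G.V := G.edge_sub _ hab (by simp)
  have ha := hy a haV
  have hb := hy b hbV
  have hedge : ∀ (u v : ℕ) (h : {u, v} ∈ G.E), μ ⟨{u, v}, h⟩ =
      (1 - y u ⬝ᵥ y v) + (1 - y u ⬝ᵥ y v) := by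
    intro u v h
    have hu := hy u (G.edge_sub _ h (by simp))
    have hv := hy v (G.edge_sub _ h (by simp))
    rw [← hμy u v h, sub_dotProduct, dotProduct_sub, dotProduct_sub, hu, hv,
      dotProduct_comm (y v) (y u)]
    ring
  have hg : (y a ⬝ᵥ y b) ^ 2 ≠ 1 := by
    intro hg
    refine hμ.transcendental ⟨{a, b}, hab⟩ ?_
    have halg : IsAlgebraic ℚ (y a ⬝ᵥ y b) := by
      refine IsAlgebraic.of_pow (n := 2) (by norm_num) ?_
      rw [hg]
      exact isAlgebraic_one
    rw [hedge]
    exact (isAlgebraic_one.sub halg).add (isAlgebraic_one.sub halg)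
  have hcardE : Nat.card G.E = 2 * G.V.card - 3 := by simp [hE]
  have two_le : ({a, b} : Finset ℕ).card ≤ G.V.card := Finset.card_le_card (G.edge_sub _ hab)
  rw [Finset.card_pair hne] at two_le
  set W := (G.V.erase a).erase b with hW
  have hWcard : W.card = G.V.card - 2 := by
    rw [hW, Finset.card_erase_of_mem (Finset.mem_erase.2 ⟨hne.symm, hbV⟩),
      Finset.card_erase_of_mem haV]
    omega
  have hgen : ∀ T : Set F, IsAlgebraic (adjoin ℚ T) (y a ⬝ᵥ y b) →
      (∀ v ∈ W, IsAlgebraic (adjoin ℚ T) (y v ⬝ᵥ y a)) →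
      (∀ v ∈ W, IsAlgebraic (adjoin ℚ T) (y v ⬝ᵥ y b)) →
      (∀ u ∈ G.V, ∀ v ∈ G.V, IsAlgebraic (adjoin ℚ T) (y u ⬝ᵥ y v)) ∧
      (∀ v ∈ G.V, IsAlgebraic (adjoin ℚ T) (Matrix.of ![y a, y b, y v]).det) ∧
      ∀ e, IsAlgebraic (adjoin ℚ T) (μ e) := by
    intro T hgT hpT hqT
    have hp : ∀ v ∈ G.V, IsAlgebraic (adjoin ℚ T) (y v ⬝ᵥ y a) := by
      intro v hv
      rcases eq_or_ne v a with rfl | hva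
      · rw [ha]; exact isAlgebraic_one
      rcases eq_or_ne v b with rfl | hvb
      · rwa [dotProduct_comm]
      exact hpT v (Finset.mem_erase.2 ⟨hvb, Finset.mem_erase.2 ⟨hva, hv⟩⟩)
    have hq : ∀ v ∈ G.V, IsAlgebraic (adjoin ℚ T) (y v ⬝ᵥ y b) := by
      intro v hv
      rcases eq_or_ne v b with rfl | hvb
      · rw [hb]; exact isAlgebraic_one
      rcases eq_or_ne v a with rfl | hva
      · exact hgT
      exact hqT v (Finset.mem_erase.2 ⟨hvb, Finset.mem_erase.2 ⟨hva, hv⟩⟩)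
    obtain ⟨hd, hgram⟩ := isAlgebraic_gram_of_frame ha hb hg hgT
    have hgram' : ∀ u ∈ G.V, ∀ v ∈ G.V, IsAlgebraic (adjoin ℚ T) (y u ⬝ᵥ y v) :=
      fun u hu v hv => hgram _ _ (hy u hu) (hy v hv) (hp u hu) (hq u hu) (hp v hv) (hq v hv)
    refine ⟨hgram', fun v hv => hd _ (hy v hv) (hp v hv) (hq v hv), ?_⟩
    rintro ⟨e, he⟩
    obtain ⟨u, v, -, rfl⟩ := Finset.card_eq_two.1 (G.edge_two e he)
    rw [hedge]
    have huv := isAlgebraic_one.sub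
      (hgram' u (G.edge_sub _ he (by simp)) v (G.edge_sub _ he (by simp)))
    exact huv.add huv
  have hmem : ∀ {T : Set F} {x : F}, x ∈ T → IsAlgebraic (adjoin ℚ T) x := fun {T x} hx =>
    isAlgebraic_algebraMap (⟨x, subset_adjoin hx⟩ : adjoin ℚ T)
  have hfinal : ∀ T : Finset F, (∀ e, IsAlgebraic (adjoin ℚ (T : Set F)) (μ e)) →
      G.E.card ≤ T.card ∧ (T.card ≤ G.E.card → ∀ x : F, IsAlgebraic (adjoin ℚ (T : Set F)) x →
        IsAlgebraic (adjoin ℚ (Set.range μ)) x) := by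
    intro T hT
    have := isAlgebraic_adjoin_range_of_ncard_le hμ T.finite_toSet hT
    rwa [Set.ncard_coe_finset, hcardE, ← hE] at this
  have hlow : ∀ v ∈ G.V, v ≠ a → v ≠ b → (Matrix.of ![y a, y b, y v]).det ≠ 0 := by
    intro v hv hva hvb hd
    have hvW : v ∈ W := Finset.mem_erase.2 ⟨hvb, Finset.mem_erase.2 ⟨hva, hv⟩⟩
    set T : Finset F := insert (y a ⬝ᵥ y b)
      (W.image (fun v => y v ⬝ᵥ y a) ∪ (W.erase v).image (fun v => y v ⬝ᵥ y b)) with hT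
    have hgT : IsAlgebraic (adjoin ℚ (T : Set F)) (y a ⬝ᵥ y b) := hmem (by simp [hT])
    have hpT : ∀ w ∈ W, IsAlgebraic (adjoin ℚ (T : Set F)) (y w ⬝ᵥ y a) := fun w hw =>
      hmem (Finset.mem_insert_of_mem (Finset.mem_union_left _ (Finset.mem_image_of_mem _ hw)))
    have hqT : ∀ w ∈ W, IsAlgebraic (adjoin ℚ (T : Set F)) (y w ⬝ᵥ y b) := by
      intro w hw
      rcases eq_or_ne w v with rfl | hwv
      · have hgp := hgT.mul (hpT w hw)
        have key := gram_mul_eq_dotProduct ha hb (y w) (y w)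
        rw [hd, hy w hv] at key
        have hsq : IsAlgebraic (adjoin ℚ (T : Set F))
            (y w ⬝ᵥ y b - (y a ⬝ᵥ y b) * (y w ⬝ᵥ y a)) := by
          refine IsAlgebraic.of_pow (n := 2) (by norm_num) ?_
          have : (y w ⬝ᵥ y b - (y a ⬝ᵥ y b) * (y w ⬝ᵥ y a)) ^ 2 =
              (1 - (y a ⬝ᵥ y b) ^ 2) * (1 - (y w ⬝ᵥ y a) ^ 2) := by
            linear_combination -key
          rw [this]
          exact (isAlgebraic_one.sub (hgT.pow 2)).mul
            (isAlgebraic_one.sub ((hpT w hw).pow 2))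
        simpa using hsq.add hgp
      · exact hmem (Finset.mem_insert_of_mem (Finset.mem_union_right _
          (Finset.mem_image_of_mem _ (Finset.mem_erase.2 ⟨hwv, hw⟩))))
    have h1 := (hfinal T (hgen T hgT hpT hqT).2.2).1
    have h2 : T.card ≤ W.card + (W.erase v).card + 1 :=
      (Finset.card_insert_le _ _).trans (Nat.add_le_add_right ((Finset.card_union_le _ _).trans
        (Nat.add_le_add Finset.card_image_le Finset.card_image_le)) 1)
    have h3 := Finset.card_erase_of_mem hvW
    have h4 : 0 < W.card := Finset.card_pos.2 ⟨v, hvW⟩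
    omega
  set T : Finset F := insert (y a ⬝ᵥ y b)
    (W.image (fun v => y v ⬝ᵥ y a) ∪ W.image (fun v => y v ⬝ᵥ y b)) with hT
  obtain ⟨hgram, hdet, hμT⟩ := hgen T (hmem (by simp [hT]))
    (fun w hw => hmem (Finset.mem_insert_of_mem
      (Finset.mem_union_left _ (Finset.mem_image_of_mem _ hw))))
    (fun w hw => hmem (Finset.mem_insert_of_mem
      (Finset.mem_union_right _ (Finset.mem_image_of_mem _ hw))))
  have hTcard : T.card ≤ W.card + W.card + 1 :=
    (Finset.card_insert_le _ _).trans (Nat.add_le_add_right ((Finset.card_union_le _ _).trans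
      (Nat.add_le_add Finset.card_image_le Finset.card_image_le)) 1)
  have htransfer := (hfinal T hμT).2 (by omega)
  exact ⟨fun u hu v hv => htransfer _ (hgram u hu v hv), fun v hv => htransfer _ (hdet v hv), hlow⟩

theorem exists_rotation_of_gram_eq {F : Type*} [Field F] {Y Y' : Matrix (Fin 3) (Fin 3) F}
    (hdet : Y.det = Y'.det) (h0 : Y.det ≠ 0) (hgram : Y * Y.transpose = Y' * Y'.transpose) :
    ∃ A : Matrix (Fin 3) (Fin 3) F, A * A.transpose = 1 ∧ A.det = 1 ∧
      ∀ x x', Y.mulVec x = Y'.mulVec x' → x' = A.mulVec x := by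
  have hu : IsUnit Y'.det := (hdet ▸ h0).isUnit
  refine ⟨Y'⁻¹ * Y, ?_, ?_, ?_⟩
  · rw [Matrix.transpose_mul, Matrix.mul_assoc, ← Matrix.mul_assoc Y, hgram, Matrix.mul_assoc Y',
      ← Matrix.mul_assoc, Matrix.nonsing_inv_mul _ hu, Matrix.one_mul, ← Matrix.transpose_mul,
      Matrix.nonsing_inv_mul _ hu, Matrix.transpose_one]
  · rw [Matrix.det_mul, hdet, ← Matrix.det_mul, Matrix.nonsing_inv_mul _ hu, Matrix.det_one]
  · intro x x' h
    rw [← Matrix.mulVec_mulVec, h, Matrix.mulVec_mulVec, Matrix.nonsing_inv_mul _ hu,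
      Matrix.one_mulVec]

open MvPolynomial in
theorem finite_invariants (G : GeoGraph) (hE : G.E.card = 2 * G.V.card - 3) {a b c : ℕ}
    (hne : a ≠ b) (hab : {a, b} ∈ G.E) (hc : c ∈ G.V) {μ : G.E → ℂ}
    (hμ : AlgebraicIndependent ℚ μ) (S : Set (ℕ → Fin 3 → ℂ))
    (hS : ∀ ρ ∈ S, ∀ v ∈ G.V, ρ v ⬝ᵥ ρ v = 1)
    (hSμ : ∀ ρ ∈ S, ∀ (u v : ℕ) (h : {u, v} ∈ G.E),
      (ρ u - ρ v) ⬝ᵥ (ρ u - ρ v) = μ ⟨{u, v}, h⟩) :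
    (∀ u ∈ G.V, ∀ v ∈ G.V, ((fun ρ => ρ u ⬝ᵥ ρ v) '' S).Finite) ∧
    ((fun ρ => (Matrix.of ![ρ a, ρ b, ρ c]).det) '' S).Finite := by
  classical
  let K := IntermediateField.adjoin ℚ (Set.range μ)
  let κ : G.E → K := fun e => ⟨μ e, IntermediateField.subset_adjoin _ _ ⟨e, rfl⟩⟩
  have hκ : AlgebraicIndependent ℚ κ := AlgebraicIndependent.of_comp K.val hμ
  let r : (ℕ → Fin 3 → ℂ) → (G.V × Fin 3 → ℂ) := fun ρ p => ρ p.1 p.2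
  let X' : ℕ → Fin 3 → MvPolynomial (G.V × Fin 3) K := fun v i =>
    if h : v ∈ G.V then X (⟨v, h⟩, i) else 0
  have hX : ∀ ρ, ∀ v ∈ G.V, ∀ i, aeval (r ρ) (X' v i) = ρ v i := by
    intro ρ v hv i
    simp [X', hv, r]
  have haV : a ∈ G.V := G.edge_sub _ hab (by simp)
  have hbV : b ∈ G.V := G.edge_sub _ hab (by simp)
  have main : ∀ (F : Type) [Field F] [Algebra K F] (y : G.V × Fin 3 → F),
      (∀ p : MvPolynomial (G.V × Fin 3) K, (∀ s ∈ r '' S, aeval s p = 0) → aeval y p = 0) →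
      (∀ u ∈ G.V, ∀ v ∈ G.V, IsAlgebraic K (aeval y (X' u ⬝ᵥ X' v))) ∧
      IsAlgebraic K (aeval y (Matrix.of ![X' a, X' b, X' c]).det) := by
    intro F _ _ y hy
    have : CharZero F := charZero_of_injective_algebraMap (algebraMap K F).injective
    let η : ℕ → Fin 3 → F := fun v i => aeval y (X' v i)
    let ν : G.E → F := fun e => algebraMap K F (κ e)
    have hν : AlgebraicIndependent ℚ ν :=
      hκ.map' (f := (algebraMap K F).toRatAlgHom) (algebraMap K F).injective
    obtain ⟨h1, h2, -⟩ := isAlgebraic_of_induces G hE hne hab (y := η) (μ := ν)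
      (fun v hv => by
        have := hy (X' v ⬝ᵥ X' v - 1) (by
          rintro _ ⟨ρ, hρ, rfl⟩
          have := hS ρ hρ v hv
          simp only [dotProduct, Fin.sum_univ_three, map_sub, map_add, map_mul, map_one,
            hX ρ v hv] at this ⊢
          rw [this, sub_self])
        simp only [dotProduct, Fin.sum_univ_three, map_sub, map_add, map_mul, map_one,
          sub_eq_zero, η] at this ⊢
        exact this) hν
      (fun u v h => by
        have hu := G.edge_sub _ h (show u ∈ _ by simp)
        have hv := G.edge_sub _ h (show v ∈ _ by simp)
        have := hy ((X' u - X' v) ⬝ᵥ (X' u - X' v) - C (κ ⟨{u, v}, h⟩)) (by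
          rintro _ ⟨ρ, hρ, rfl⟩
          have := hSμ ρ hρ u v h
          simp only [dotProduct, Fin.sum_univ_three, Pi.sub_apply, map_sub, map_add, map_mul,
            hX ρ v hv, hX ρ u hu, aeval_C] at this ⊢
          rw [this]
          exact sub_self _)
        simp only [dotProduct, Fin.sum_univ_three, Pi.sub_apply, map_sub, map_add, map_mul, aeval_C,
          sub_eq_zero, η] at this ⊢
        exact this)
    have htr : ∀ x : F, IsAlgebraic (Algebra.adjoin ℚ (Set.range ν)) x → IsAlgebraic K x := by
      intro x hx
      have hle : Algebra.adjoin ℚ (Set.range ν) ≤ (algebraMap K F).toRatAlgHom.range := by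
        rw [Algebra.adjoin_le_iff]
        rintro _ ⟨e, rfl⟩
        exact ⟨κ e, rfl⟩
      have hx' := hx.tower_top_of_subalgebra_le hle
      refine IsAlgebraic.of_ringHom_of_comp_eq
        (f := ((algebraMap K F).toRatAlgHom.rangeRestrict : K →+* _)) (g := RingHom.id F) hx'
        (AlgHom.rangeRestrict_surjective _) Function.injective_id ?_
      rfl
    refine ⟨fun u hu v hv => ?_, ?_⟩
    · have := htr _ (h1 u hu v hv)
      simp only [dotProduct, map_sum, map_mul]
      exact this
    · have := htr _ (h2 c hc)
      simp only [Matrix.det_fin_three, Matrix.of_apply, Matrix.cons_val, map_add, map_sub,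
        map_mul] at this ⊢
      exact this
  constructor
  · intro u hu v hv
    have := finite_image_aeval_of_isAlgebraic (r '' S) (X' u ⬝ᵥ X' v)
      (fun F _ _ y hy => (main F y hy).1 u hu v hv)
    rw [Set.image_image] at this
    refine this.subset (Set.image_congr fun ρ _ => ?_).subset
    simp only [dotProduct, map_sum, map_mul, hX ρ u hu, hX ρ v hv]
  · have := finite_image_aeval_of_isAlgebraic (r '' S) (Matrix.of ![X' a, X' b, X' c]).det
      (fun F _ _ y hy => (main F y hy).2)
    rw [Set.image_image] at this
    refine this.subset (Set.image_congr fun ρ _ => ?_).subset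
    simp only [Matrix.det_fin_three, Matrix.of_apply, Matrix.cons_val, map_add, map_sub,
      map_mul, hX ρ a haV, hX ρ b hbV, hX ρ c hc]

theorem even_natCard_of_fixedPointFree {α : Type*} [Finite α] {f : α → α}
    (hf : Function.Involutive f) (hfix : ∀ x, f x ≠ x) : Even (Nat.card α) := by
  classical
  have := Fintype.ofFinite α
  have h : ∑ _x : α, (1 : ZMod 2) = 0 :=
    Finset.sum_involution (fun x _ => f x) (fun _ _ => by decide) (fun x _ _ => hfix x)
      (fun _ _ => Finset.mem_univ _) (fun x _ => hf x)
  rw [Nat.card_eq_fintype_card, ← ZMod.natCast_eq_zero_iff_even]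
  simpa using h

/-- A minimally rigid graph admitting a calligraphic split has an even (finite)
number of congruence classes of spherical realizations for every generic
edge-length assignment. -/
theorem sphere_count_even_of_calligraphic_split (G G₁ G₂ : GeoGraph)
    (hG : Laman G) (hsplit : CalligraphicSplit G G₁ G₂)
    (lam : Finset ℕ → ℝ) (hlam : Generic G lam) :
    Finite (SphereClasses G lam) ∧ Even (Nat.card (SphereClasses G lam)) := by
  classical
  obtain ⟨⟨hV, hEU, -, -⟩, ⟨h012, h12, -, -⟩, -⟩ := hsplit
  have hedge : ({1, 2} : Finset ℕ) ∈ G.E := hEU ▸ Finset.mem_union_left _ h12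
  have hsub : ({0, 1, 2} : Finset ℕ) ⊆ G.V := h012.trans (hV ▸ Finset.subset_union_left)
  have h0 : 0 ∈ G.V := hsub (by simp)
  have h1 : 1 ∈ G.V := hsub (by simp)
  have h2 : 2 ∈ G.V := hsub (by simp)
  let μ : G.E → ℂ := fun e => (lam e.1 : ℂ)
  have hμ : AlgebraicIndependent ℚ μ :=
    hlam.2.map' (f := (algebraMap ℝ ℂ).toRatAlgHom) (algebraMap ℝ ℂ).injective
  let S : Set (ℕ → Fin 3 → ℂ) := {ρ | SphereRealization G ρ ∧ SphereInduces G ρ lam}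
  have hS : ∀ ρ ∈ S, ∀ v ∈ G.V, ρ v ⬝ᵥ ρ v = 1 := fun ρ hρ v hv => by
    simpa only [dotProduct, pow_two] using hρ.1 v hv
  have hSμ : ∀ ρ ∈ S, ∀ (u v : ℕ) (h : {u, v} ∈ G.E),
      (ρ u - ρ v) ⬝ᵥ (ρ u - ρ v) = μ ⟨{u, v}, h⟩ := fun ρ hρ u v h => by
    simpa only [dotProduct, pow_two, Pi.sub_apply, μ] using hρ.2 u v h
  have hdet : ∀ ρ ∈ S, (Matrix.of ![ρ 1, ρ 2, ρ 0]).det ≠ 0 := fun ρ hρ =>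
    (isAlgebraic_of_induces G hG.2.1 (by norm_num) hedge (hS ρ hρ) hμ (hSμ ρ hρ)).2.2 0 h0
      (by norm_num) (by norm_num)
  obtain ⟨hfg, hfd⟩ := finite_invariants G hG.2.1 (by norm_num) hedge h0 hμ S hS hSμ
  let Φ : (ℕ → Fin 3 → ℂ) → (G.V × G.V → ℂ) × ℂ := fun ρ =>
    (fun p => ρ p.1 ⬝ᵥ ρ p.2, (Matrix.of ![ρ 1, ρ 2, ρ 0]).det)
  have hΦfin : (Φ '' S).Finite := by
    refine ((Set.Finite.pi fun p : G.V × G.V => hfg p.1 p.1.2 p.2 p.2.2).prod hfd).subset ?_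
    rintro _ ⟨ρ, hρ, rfl⟩
    exact ⟨fun p _ => ⟨ρ, hρ, rfl⟩, ⟨ρ, hρ, rfl⟩⟩
  have hΦ : ∀ ρ ρ', SphereCongruent G ρ ρ' → Φ ρ = Φ ρ' := by
    rintro ρ ρ' ⟨A, hA, hA1, h⟩
    have hA' : A.transpose * A = 1 := mul_eq_one_comm.1 hA
    refine Prod.ext (funext fun p => ?_) ?_
    · change ρ p.1 ⬝ᵥ ρ p.2 = ρ' p.1 ⬝ᵥ ρ' p.2
      rw [h _ p.1.2, h _ p.2.2, Matrix.dotProduct_mulVec, ← Matrix.mulVec_transpose,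
        Matrix.mulVec_mulVec, hA', Matrix.one_mulVec]
    · change (Matrix.of ![ρ 1, ρ 2, ρ 0]).det = (Matrix.of ![ρ' 1, ρ' 2, ρ' 0]).det
      have : Matrix.of ![ρ' 1, ρ' 2, ρ' 0] = Matrix.of ![ρ 1, ρ 2, ρ 0] * A.transpose := by
        ext i j
        rw [Matrix.mul_apply_eq_vecMul, Matrix.vecMul_transpose]
        fin_cases i <;> simp [h, h0, h1, h2] <;> rfl
      rw [this, Matrix.det_mul, Matrix.det_transpose, hA1, mul_one]
  have hΦinj : ∀ ρ ∈ S, ∀ ρ', Φ ρ = Φ ρ' → SphereCongruent G ρ ρ' := by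
    intro ρ hρ ρ' h
    have hg : ∀ u ∈ G.V, ∀ v ∈ G.V, ρ u ⬝ᵥ ρ v = ρ' u ⬝ᵥ ρ' v := fun u hu v hv =>
      congrFun (congrArg Prod.fst h) (⟨u, hu⟩, ⟨v, hv⟩)
    obtain ⟨A, hA, hA1, hAx⟩ := exists_rotation_of_gram_eq (congrArg Prod.snd h) (hdet ρ hρ) (by
      ext i j
      change ![ρ 1, ρ 2, ρ 0] i ⬝ᵥ ![ρ 1, ρ 2, ρ 0] j =
        ![ρ' 1, ρ' 2, ρ' 0] i ⬝ᵥ ![ρ' 1, ρ' 2, ρ' 0] j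
      fin_cases i <;> fin_cases j <;> exact hg _ (by assumption) _ (by assumption))
    refine ⟨A, hA, hA1, fun v hv => hAx _ _ (funext fun i => ?_)⟩
    change ![ρ 1, ρ 2, ρ 0] i ⬝ᵥ ρ v = ![ρ' 1, ρ' 2, ρ' 0] i ⬝ᵥ ρ' v
    fin_cases i <;> exact hg _ (by assumption) _ hv
  let Ψ : SphereClasses G lam → Φ '' S := Quot.lift (fun ρ => ⟨Φ ρ.1, ρ.1, ρ.2, rfl⟩)
    fun ρ ρ' h => Subtype.ext (hΦ _ _ h)
  have hΨ : Function.Injective Ψ := by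
    rintro ⟨ρ⟩ ⟨ρ'⟩ h
    exact Quot.sound (hΦinj _ ρ.2 _ (congrArg Subtype.val h))
  have : Finite (Φ '' S) := hΦfin
  have hfinite : Finite (SphereClasses G lam) := Finite.of_injective Ψ hΨ
  have hneg : ∀ ρ ∈ S, -ρ ∈ S := by
    refine fun ρ hρ => ⟨fun v hv => ?_, fun u v h => ?_⟩
    · simpa using hρ.1 v hv
    · rw [← hρ.2 u v h]
      refine Finset.sum_congr rfl fun i _ => ?_
      simp only [Pi.neg_apply]
      ring
  let f : SphereClasses G lam → SphereClasses G lam :=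
    Quot.map (fun ρ => ⟨-ρ.1, hneg _ ρ.2⟩) (by
      rintro ρ ρ' ⟨A, hA, hA1, h⟩
      refine ⟨A, hA, hA1, fun v hv => ?_⟩
      simp only [Pi.neg_apply]
      rw [h v hv, Matrix.mulVec_neg])
  refine ⟨hfinite, even_natCard_of_fixedPointFree (f := f) ?_ ?_⟩
  · rintro ⟨ρ⟩
    exact congrArg (Quot.mk _) (Subtype.ext (neg_neg ρ.1))
  · rintro ⟨ρ⟩ h
    have hd : (Matrix.of ![(-ρ.1) 1, (-ρ.1) 2, (-ρ.1) 0]).det =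
        (Matrix.of ![ρ.1 1, ρ.1 2, ρ.1 0]).det :=
      congrArg (fun x => x.1.2) (congrArg Ψ h)
    have hn : (Matrix.of ![(-ρ.1) 1, (-ρ.1) 2, (-ρ.1) 0]).det =
        -(Matrix.of ![ρ.1 1, ρ.1 2, ρ.1 0]).det := by
      simp only [Matrix.det_fin_three, Matrix.of_apply, Matrix.cons_val, Pi.neg_apply]
      ring
    exact hdet _ ρ.2 (self_eq_neg.1 (hd.symm.trans hn))
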